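/- Let p ≥ 2 and let t be an integer with 1 ≤ t ≤ p. There exists a constant C depending only on p and t such that for every axis-parallel closed rectangle τ = [x_0, x_0+h] × [y_0, y_0+k] (h, k > 0) and every function w that is (t+2)-times continuously differentiable on an open neighbourhood of τ: ‖R^τ w‖_{L²(τ)} ≤ C Σ_{r=0}^{t+2} h^{t+2−r} k^{r} ‖∂_x^{t+2−r} ∂_y^{r} w‖_{L²(τ)}, where R^τ w := I_p^τ(π_{p+1}^τ w − w) − (π_{p+1}^τ w − w). The constant C is independent of h, k and w (in particular independent of the aspect ratio of τ). -/

import Mathlib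

/-- The Legendre polynomial of degree `p`, given by Rodrigues' formula
`L_p(t) = (1/(2^p p!)) (d/dt)^p (t² − 1)^p`. -/
noncomputable def legendre (p : ℕ) : Polynomial ℝ :=
  Polynomial.C (1 / (2 ^ p * (Nat.factorial p) : ℝ)) *
    Polynomial.derivative^[p] ((Polynomial.X ^ 2 - 1) ^ p)

/-- The Gauß–Lobatto points of order `p`: `−1 = t_0 < t_1 < ⋯ < t_p = 1`, the zeros of
`(1 − t²) L_p'(t)`. -/
def IsGLNodes (p : ℕ) (t : Fin (p + 1) → ℝ) : Prop :=
  StrictMono t ∧ t 0 = -1 ∧ t (Fin.last p) = 1 ∧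
    ∀ i, (1 - t i ^ 2) * (Polynomial.derivative (legendre p)).eval (t i) = 0

/-- Evaluation of a bivariate polynomial at a point of `ℝ²`. -/
noncomputable def ev (q : MvPolynomial (Fin 2) ℝ) (z : ℝ × ℝ) : ℝ :=
  MvPolynomial.eval ![z.1, z.2] q

/-- `q ∈ Q_k`: degree at most `k` in each of the two variables. -/
def memQ (k : ℕ) (q : MvPolynomial (Fin 2) ℝ) : Prop :=
  q.degreeOf 0 ≤ k ∧ q.degreeOf 1 ≤ k

/-- The reference element `τ̂ = [−1,1]²`. -/
def refSq : Set (ℝ × ℝ) := Set.Icc (-1, -1) (1, 1)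

/-- `q` is the vertex-edge-cell interpolant of `v` into `Q_k(τ̂)`: it matches `v` at the
four vertices of `τ̂ = [−1,1]²`, has the same moments against `P_{k−2}` on each of the
four edges, and the same moments against `Q_{k−2}` on the cell. -/
def IsVEC (k : ℕ) (v : ℝ × ℝ → ℝ) (q : MvPolynomial (Fin 2) ℝ) : Prop :=
  memQ k q ∧
  (∀ a ∈ ({-1, 1} : Set ℝ), ∀ b ∈ ({-1, 1} : Set ℝ), ev q (a, b) = v (a, b)) ∧
  (∀ b ∈ ({-1, 1} : Set ℝ), ∀ r : Polynomial ℝ, r.natDegree ≤ k - 2 →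
    ∫ s in (-1 : ℝ)..1, (ev q (s, b) - v (s, b)) * r.eval s = 0) ∧
  (∀ a ∈ ({-1, 1} : Set ℝ), ∀ r : Polynomial ℝ, r.natDegree ≤ k - 2 →
    ∫ s in (-1 : ℝ)..1, (ev q (a, s) - v (a, s)) * r.eval s = 0) ∧
  (∀ r : MvPolynomial (Fin 2) ℝ, memQ (k - 2) r →
    ∫ x in (-1 : ℝ)..1, ∫ y in (-1 : ℝ)..1, (ev q (x, y) - v (x, y)) * ev r (x, y) = 0)

/-- `q ∈ Q_k(τ̂)` is the tensor-product Lagrange interpolant of `v` at the grid of the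
nodes `s_0,…,s_k`. -/
def IsLag (k : ℕ) (s : Fin (k + 1) → ℝ) (v : ℝ × ℝ → ℝ) (q : MvPolynomial (Fin 2) ℝ) :
    Prop :=
  memQ k q ∧ ∀ i j, ev q (s i, s j) = v (s i, s j)

/-- The affine reference mapping `F_τ : τ̂ = [−1,1]² → τ = [x₀,x₀+h] × [y₀,y₀+k]`. -/
noncomputable def Fmap (x0 y0 h k : ℝ) (z : ℝ × ℝ) : ℝ × ℝ :=
  (x0 + h * (z.1 + 1) / 2, y0 + k * (z.2 + 1) / 2)

/-- The inverse of the affine reference mapping `F_τ`. -/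
noncomputable def Finv (x0 y0 h k : ℝ) (z : ℝ × ℝ) : ℝ × ℝ :=
  (2 * (z.1 - x0) / h - 1, 2 * (z.2 - y0) / k - 1)

/-- Partial derivative in the first variable. -/
noncomputable def pdx (f : ℝ × ℝ → ℝ) : ℝ × ℝ → ℝ :=
  fun z => deriv (fun s => f (s, z.2)) z.1

/-- Partial derivative in the second variable. -/
noncomputable def pdy (f : ℝ × ℝ → ℝ) : ℝ × ℝ → ℝ :=
  fun z => deriv (fun s => f (z.1, s)) z.2

/-- The `L²`-norm over the set `S`. -/
noncomputable def l2norm (S : Set (ℝ × ℝ)) (f : ℝ × ℝ → ℝ) : ℝ :=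
  Real.sqrt (∫ z in S, (f z) ^ 2)

theorem pdx_eq_fderiv {f : ℝ × ℝ → ℝ} (hf : Differentiable ℝ f) :
    pdx f = fun z => fderiv ℝ f z (1, 0) := by
  funext z
  have h : HasDerivAt (fun s : ℝ => (s, z.2)) ((1 : ℝ), (0 : ℝ)) z.1 :=
    (hasDerivAt_id _).prodMk (hasDerivAt_const _ _)
  exact ((hf z).hasFDerivAt.comp_hasDerivAt z.1 h).deriv

theorem pdy_eq_fderiv {f : ℝ × ℝ → ℝ} (hf : Differentiable ℝ f) :
    pdy f = fun z => fderiv ℝ f z (0, 1) := by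
  funext z
  have h : HasDerivAt (fun s : ℝ => (z.1, s)) ((0 : ℝ), (1 : ℝ)) z.2 :=
    (hasDerivAt_const _ _).prodMk (hasDerivAt_id _)
  exact ((hf z).hasFDerivAt.comp_hasDerivAt z.2 h).deriv

theorem hasDerivAt_pdx {f : ℝ × ℝ → ℝ} (hf : Differentiable ℝ f) (x y : ℝ) :
    HasDerivAt (fun s => f (s, y)) (pdx f (x, y)) x :=
  DifferentiableAt.hasDerivAt
    ((hf (x, y)).comp x (differentiableAt_id.prodMk (differentiableAt_const _)))

theorem hasDerivAt_pdy {f : ℝ × ℝ → ℝ} (hf : Differentiable ℝ f) (x y : ℝ) :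
    HasDerivAt (fun s => f (x, s)) (pdy f (x, y)) y :=
  DifferentiableAt.hasDerivAt
    ((hf (x, y)).comp y ((differentiableAt_const _).prodMk differentiableAt_id))

theorem ContDiff.differentiable_of_succ {n : ℕ} {f : ℝ × ℝ → ℝ} (hf : ContDiff ℝ (n + 1 : ℕ) f) :
    Differentiable ℝ f :=
  hf.differentiable (by exact_mod_cast Nat.succ_ne_zero n)

theorem ContDiff.pdx {n : ℕ} {f : ℝ × ℝ → ℝ} (hf : ContDiff ℝ (n + 1 : ℕ) f) :
    ContDiff ℝ n (pdx f) := by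
  rw [pdx_eq_fderiv hf.differentiable_of_succ]
  exact (hf.fderiv_right (m := n) (by norm_cast)).clm_apply contDiff_const

theorem ContDiff.pdy {n : ℕ} {f : ℝ × ℝ → ℝ} (hf : ContDiff ℝ (n + 1 : ℕ) f) :
    ContDiff ℝ n (pdy f) := by
  rw [pdy_eq_fderiv hf.differentiable_of_succ]
  exact (hf.fderiv_right (m := n) (by norm_cast)).clm_apply contDiff_const

theorem ContDiff.pdx_iterate {n : ℕ} (i : ℕ) {f : ℝ × ℝ → ℝ} (hf : ContDiff ℝ (n + i : ℕ) f) :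
    ContDiff ℝ n (_root_.pdx^[i] f) := by
  induction i generalizing f with
  | zero => exact hf
  | succ i ih => exact ih (ContDiff.pdx (n := n + i) hf)

theorem ContDiff.pdy_iterate {n : ℕ} (i : ℕ) {f : ℝ × ℝ → ℝ} (hf : ContDiff ℝ (n + i : ℕ) f) :
    ContDiff ℝ n (_root_.pdy^[i] f) := by
  induction i generalizing f with
  | zero => exact hf
  | succ i ih => exact ih (ContDiff.pdy (n := n + i) hf)

theorem pdx_sub {f g : ℝ × ℝ → ℝ} (hf : Differentiable ℝ f) (hg : Differentiable ℝ g) :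
    pdx (f - g) = pdx f - pdx g := by
  rw [pdx_eq_fderiv hf, pdx_eq_fderiv hg, pdx_eq_fderiv (hf.sub hg)]
  funext z
  rw [fderiv_sub (hf z) (hg z)]
  rfl

theorem pdy_sub {f g : ℝ × ℝ → ℝ} (hf : Differentiable ℝ f) (hg : Differentiable ℝ g) :
    pdy (f - g) = pdy f - pdy g := by
  rw [pdy_eq_fderiv hf, pdy_eq_fderiv hg, pdy_eq_fderiv (hf.sub hg)]
  funext z
  rw [fderiv_sub (hf z) (hg z)]
  rfl

theorem pdx_iterate_sub (i : ℕ) {f g : ℝ × ℝ → ℝ} (hf : ContDiff ℝ i f) (hg : ContDiff ℝ i g) :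
    pdx^[i] (f - g) = pdx^[i] f - pdx^[i] g := by
  induction i generalizing f g with
  | zero => rfl
  | succ i ih =>
    rw [Function.iterate_succ_apply, pdx_sub hf.differentiable_of_succ hg.differentiable_of_succ,
      ih hf.pdx hg.pdx]
    rfl

theorem pdy_iterate_sub (i : ℕ) {f g : ℝ × ℝ → ℝ} (hf : ContDiff ℝ i f) (hg : ContDiff ℝ i g) :
    pdy^[i] (f - g) = pdy^[i] f - pdy^[i] g := by
  induction i generalizing f g with
  | zero => rfl
  | succ i ih =>
    rw [Function.iterate_succ_apply, pdy_sub hf.differentiable_of_succ hg.differentiable_of_succ,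
      ih hf.pdy hg.pdy]
    rfl

theorem pdx_iterate_pdy_iterate_sub (i j : ℕ) {f g : ℝ × ℝ → ℝ}
    (hf : ContDiff ℝ (i + j : ℕ) f) (hg : ContDiff ℝ (i + j : ℕ) g) :
    pdx^[i] (pdy^[j] (f - g)) = pdx^[i] (pdy^[j] f) - pdx^[i] (pdy^[j] g) := by
  rw [pdy_iterate_sub j (hf.of_le (by norm_cast; omega)) (hg.of_le (by norm_cast; omega)),
    pdx_iterate_sub i (hf.pdy_iterate j) (hg.pdy_iterate j)]

theorem pdy_pdx_comm {f : ℝ × ℝ → ℝ} (hf : ContDiff ℝ 2 f) : pdy (pdx f) = pdx (pdy f) := by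
  have hf' : ContDiff ℝ (1 + 1 : ℕ) f := hf
  have hd : Differentiable ℝ (fderiv ℝ f) :=
    (hf.fderiv_right (m := 1) (by norm_num)).differentiable (by norm_num)
  rw [pdy_eq_fderiv (hf'.pdx.differentiable (by norm_num)),
    pdx_eq_fderiv (hf'.pdy.differentiable (by norm_num)),
    pdx_eq_fderiv hf'.differentiable_of_succ, pdy_eq_fderiv hf'.differentiable_of_succ]
  funext z
  have key := (hf.contDiffAt (x := z)).isSymmSndFDerivAt (by simp)
  have e : ∀ u v : ℝ × ℝ, fderiv ℝ (fun z => fderiv ℝ f z u) z v =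
      fderiv ℝ (fderiv ℝ f) z v u := by
    intro u v
    rw [fderiv_clm_apply (hd z) (differentiableAt_const _)]
    simp
  rw [e, e]
  exact key _ _

theorem pdy_pdx_iterate_comm (i : ℕ) {f : ℝ × ℝ → ℝ} (hf : ContDiff ℝ (i + 1 : ℕ) f) :
    pdy (pdx^[i] f) = pdx^[i] (pdy f) := by
  induction i generalizing f with
  | zero => rfl
  | succ i ih =>
    rw [Function.iterate_succ_apply, ih hf.pdx, Function.iterate_succ_apply,
      pdy_pdx_comm (hf.of_le (by norm_cast; omega))]

theorem pdx_iterate_eqOn {V : Set (ℝ × ℝ)} (hV : IsOpen V) (i : ℕ) {f g : ℝ × ℝ → ℝ}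
    (h : Set.EqOn f g V) : Set.EqOn (pdx^[i] f) (pdx^[i] g) V := by
  induction i generalizing f g with
  | zero => exact h
  | succ i ih =>
    refine ih fun z hz => Filter.EventuallyEq.deriv_eq ?_
    have hc : Continuous fun s : ℝ => (s, z.2) := by fun_prop
    filter_upwards [(hV.preimage hc).mem_nhds hz] with s hs using h hs

theorem pdy_iterate_eqOn {V : Set (ℝ × ℝ)} (hV : IsOpen V) (i : ℕ) {f g : ℝ × ℝ → ℝ}
    (h : Set.EqOn f g V) : Set.EqOn (pdy^[i] f) (pdy^[i] g) V := by
  induction i generalizing f g with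
  | zero => exact h
  | succ i ih =>
    refine ih fun z hz => Filter.EventuallyEq.deriv_eq ?_
    have hc : Continuous fun s : ℝ => (z.1, s) := by fun_prop
    filter_upwards [(hV.preimage hc).mem_nhds hz] with s hs using h hs

theorem pdx_iterate_sum_monomial {ι : Type*} (s : Finset ι) (i : ℕ) (c : ι → ℝ) (a b : ι → ℕ) :
    pdx^[i] (fun z => ∑ r ∈ s, c r * z.1 ^ a r * z.2 ^ b r) =
      fun z => ∑ r ∈ s, c r * (a r).descFactorial i * z.1 ^ (a r - i) * z.2 ^ b r := by
  induction i with
  | zero => simp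
  | succ i ih =>
    rw [Function.iterate_succ_apply', ih]
    funext z
    refine HasDerivAt.deriv ?_
    refine HasDerivAt.fun_sum fun r _ => ?_
    refine (((hasDerivAt_pow (a r - i) z.1).const_mul
      (c r * (a r).descFactorial i)).mul_const (z.2 ^ b r)).congr_deriv ?_
    rw [Nat.descFactorial_succ, Nat.sub_sub]
    push_cast
    ring

theorem pdy_iterate_sum_monomial {ι : Type*} (s : Finset ι) (i : ℕ) (c : ι → ℝ) (a b : ι → ℕ) :
    pdy^[i] (fun z => ∑ r ∈ s, c r * z.1 ^ a r * z.2 ^ b r) =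
      fun z => ∑ r ∈ s, c r * (b r).descFactorial i * z.1 ^ a r * z.2 ^ (b r - i) := by
  induction i with
  | zero => simp
  | succ i ih =>
    rw [Function.iterate_succ_apply', ih]
    funext z
    refine HasDerivAt.deriv ?_
    refine HasDerivAt.fun_sum fun r _ => ?_
    refine ((hasDerivAt_pow (b r - i) z.2).const_mul
      (c r * (b r).descFactorial i * z.1 ^ a r)).congr_deriv ?_
    rw [Nat.descFactorial_succ, Nat.sub_sub]
    push_cast
    ring

/-- The integral over the reference square `[−1,1]²`, as an iterated integral. -/
noncomputable def sqInt (f : ℝ × ℝ → ℝ) : ℝ :=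
  ∫ x in (-1 : ℝ)..1, ∫ y in (-1 : ℝ)..1, f (x, y)

/-- The `L¹`-seminorm of order `n` on the reference square. -/
noncomputable def semi (n : ℕ) (f : ℝ × ℝ → ℝ) : ℝ :=
  ∑ r ∈ Finset.range (n + 1), sqInt fun z => |pdx^[n - r] (pdy^[r] f) z|

theorem continuous_integral_snd {f : ℝ × ℝ → ℝ} (hf : Continuous f) :
    Continuous fun x => ∫ y in (-1 : ℝ)..1, f (x, y) :=
  intervalIntegral.continuous_parametric_intervalIntegral_of_continuous'
    (f := fun x y => f (x, y)) hf _ _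

theorem continuous_integral_fst {f : ℝ × ℝ → ℝ} (hf : Continuous f) :
    Continuous fun y => ∫ x in (-1 : ℝ)..1, f (x, y) :=
  continuous_integral_snd (f := fun z => f (z.2, z.1)) (by fun_prop)

theorem sqInt_swap {f : ℝ × ℝ → ℝ} (hf : Continuous f) :
    sqInt f = ∫ y in (-1 : ℝ)..1, ∫ x in (-1 : ℝ)..1, f (x, y) := by
  refine MeasureTheory.intervalIntegral_intervalIntegral_swap (F := fun x y => f (x, y)) ?_
  have h := (hf.continuousOn (s := Set.Icc (-1) 1 ×ˢ Set.Icc (-1) 1)).integrableOn_compact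
    (μ := MeasureTheory.volume) (isCompact_Icc.prod isCompact_Icc)
  rw [Set.uIoc_of_le (by norm_num)]
  exact h.mono_set (Set.prod_mono Set.Ioc_subset_Icc_self Set.Ioc_subset_Icc_self)

theorem integral_mono_symm {f g : ℝ → ℝ} (hf : Continuous f) (hg : Continuous g)
    (h : ∀ x ∈ Set.Icc (-1 : ℝ) 1, f x ≤ g x) :
    ∫ x in (-1 : ℝ)..1, f x ≤ ∫ x in (-1 : ℝ)..1, g x :=
  intervalIntegral.integral_mono_on (by norm_num) (hf.intervalIntegrable _ _)
    (hg.intervalIntegrable _ _) h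

theorem sqInt_mono {f g : ℝ × ℝ → ℝ} (hf : Continuous f) (hg : Continuous g)
    (h : ∀ x ∈ Set.Icc (-1 : ℝ) 1, ∀ y ∈ Set.Icc (-1 : ℝ) 1, f (x, y) ≤ g (x, y)) :
    sqInt f ≤ sqInt g :=
  integral_mono_symm (continuous_integral_snd hf) (continuous_integral_snd hg) fun x hx =>
    integral_mono_symm (by fun_prop) (by fun_prop) (h x hx)

theorem sqInt_abs_nonneg (f : ℝ × ℝ → ℝ) : 0 ≤ sqInt fun z => |f z| :=
  intervalIntegral.integral_nonneg (by norm_num) fun _ _ =>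
    intervalIntegral.integral_nonneg (by norm_num) fun _ _ => abs_nonneg _

theorem sqInt_add {f g : ℝ × ℝ → ℝ} (hf : Continuous f) (hg : Continuous g) :
    sqInt (fun z => f z + g z) = sqInt f + sqInt g := by
  unfold sqInt
  rw [← intervalIntegral.integral_add ((continuous_integral_snd hf).intervalIntegrable _ _)
    ((continuous_integral_snd hg).intervalIntegrable _ _)]
  refine intervalIntegral.integral_congr fun x _ => ?_
  exact intervalIntegral.integral_add
    ((hf.comp (by fun_prop : Continuous fun y : ℝ => (x, y))).intervalIntegrable _ _)
    ((hg.comp (by fun_prop : Continuous fun y : ℝ => (x, y))).intervalIntegrable _ _)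

theorem sqInt_const (c : ℝ) : sqInt (fun _ => c) = 4 * c := by
  simp only [sqInt, intervalIntegral.integral_const, smul_eq_mul]
  ring

theorem sqInt_fst (f : ℝ → ℝ) : sqInt (fun z => f z.1) = 2 * ∫ x in (-1 : ℝ)..1, f x := by
  simp only [sqInt, intervalIntegral.integral_const, smul_eq_mul,
    intervalIntegral.integral_const_mul]
  ring

theorem sqInt_snd (f : ℝ → ℝ) : sqInt (fun z => f z.2) = 2 * ∫ x in (-1 : ℝ)..1, f x := by
  simp only [sqInt, intervalIntegral.integral_const, smul_eq_mul]
  ring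

theorem sqInt_sub_const {f : ℝ × ℝ → ℝ} (hf : Continuous f) (c : ℝ) :
    sqInt (fun z => f z - c) = sqInt f - 4 * c := by
  have h := sqInt_add hf (continuous_const (y := -c))
  rw [sqInt_const] at h
  simp only [sub_eq_add_neg, h]
  ring

theorem sqInt_const_mul (c : ℝ) (f : ℝ × ℝ → ℝ) :
    sqInt (fun z => c * f z) = c * sqInt f := by
  simp only [sqInt, intervalIntegral.integral_const_mul]

theorem abs_sqInt_le {f : ℝ × ℝ → ℝ} (hf : Continuous f) :
    |sqInt f| ≤ sqInt fun z => |f z| := by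
  have h1 := sqInt_mono hf hf.abs fun x _ y _ => le_abs_self (f (x, y))
  have h2 := sqInt_mono (f := fun z => (-1) * f z) (by fun_prop) hf.abs
    fun x _ y _ => by simpa using neg_le_abs (f (x, y))
  rw [sqInt_const_mul] at h2
  exact abs_le.2 ⟨by linarith, h1⟩

theorem abs_sub_le_integral_abs_deriv {φ φ' : ℝ → ℝ} (h : ∀ x, HasDerivAt φ (φ' x) x)
    (hc : Continuous φ') {x y : ℝ} (hx : x ∈ Set.Icc (-1 : ℝ) 1) (hy : y ∈ Set.Icc (-1 : ℝ) 1) :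
    |φ x - φ y| ≤ ∫ s in (-1 : ℝ)..1, |φ' s| := by
  rw [← intervalIntegral.integral_eq_sub_of_hasDerivAt (fun s _ => h s)
    (hc.intervalIntegrable y x)]
  refine (intervalIntegral.norm_integral_le_abs_integral_norm (f := φ')).trans ?_
  simp only [Real.norm_eq_abs]
  refine (intervalIntegral.abs_integral_mono_interval (c := -1) (d := 1) ?_ ?_
    (hc.abs.intervalIntegrable _ _)).trans
      (abs_of_nonneg (intervalIntegral.integral_nonneg (by norm_num) fun _ _ => abs_nonneg _)).le
  · rw [Set.uIoc_of_le (by norm_num : (-1 : ℝ) ≤ 1)]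
    exact Set.Ioc_subset_Ioc (le_inf hy.1 hx.1) (sup_le hy.2 hx.2)
  · exact Filter.Eventually.of_forall fun _ => abs_nonneg _

theorem abs_le_integral_add_integral_abs_deriv {φ φ' : ℝ → ℝ} (h : ∀ x, HasDerivAt φ (φ' x) x)
    (hc : Continuous φ') {x : ℝ} (hx : x ∈ Set.Icc (-1 : ℝ) 1) :
    |φ x| ≤ 1 / 2 * (∫ s in (-1 : ℝ)..1, |φ s|) + ∫ s in (-1 : ℝ)..1, |φ' s| := by
  have hφ : Continuous φ := continuous_iff_continuousAt.2 fun x => (h x).continuousAt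
  have := integral_mono_symm (f := fun _ => |φ x|)
    (g := fun y => |φ y| + ∫ s in (-1 : ℝ)..1, |φ' s|) continuous_const (by fun_prop)
    fun y hy => by
      have h1 := abs_sub_le_integral_abs_deriv h hc hx hy
      have h2 := abs_sub_abs_le_abs_sub (φ x) (φ y)
      linarith
  rw [intervalIntegral.integral_add (hφ.abs.intervalIntegrable _ _) (by simp),
    intervalIntegral.integral_const, intervalIntegral.integral_const] at this
  simp only [smul_eq_mul] at this
  linarith

theorem abs_sub_le_of_contDiff_one {f : ℝ × ℝ → ℝ} (hf : ContDiff ℝ 1 f) {x y x' y' : ℝ}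
    (hx : x ∈ Set.Icc (-1 : ℝ) 1) (hy : y ∈ Set.Icc (-1 : ℝ) 1)
    (hx' : x' ∈ Set.Icc (-1 : ℝ) 1) (hy' : y' ∈ Set.Icc (-1 : ℝ) 1) :
    |f (x, y) - f (x', y')| ≤ (∫ s in (-1 : ℝ)..1, |pdx f (s, y)|) +
      ∫ s in (-1 : ℝ)..1, |pdy f (x', s)| := by
  have hd : Differentiable ℝ f := hf.differentiable (by norm_num)
  have hcx : Continuous (pdx f) := (ContDiff.pdx (n := 0) hf).continuous
  have hcy : Continuous (pdy f) := (ContDiff.pdy (n := 0) hf).continuous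
  have h1 := abs_sub_le_integral_abs_deriv (fun s => hasDerivAt_pdx hd s y)
    (by fun_prop) hx hx'
  have h2 := abs_sub_le_integral_abs_deriv (fun s => hasDerivAt_pdy hd x' s)
    (by fun_prop) hy hy'
  exact (abs_sub_le _ (f (x', y)) _).trans (add_le_add h1 h2)

theorem poincare_sqInt {f : ℝ × ℝ → ℝ} (hf : ContDiff ℝ 1 f) :
    sqInt (fun z => |f z - sqInt f / 4|) ≤
      2 * (sqInt (fun z => |pdx f z|) + sqInt (fun z => |pdy f z|)) := by
  have hc : Continuous f := hf.continuous
  have hcx : Continuous (pdx f) := (ContDiff.pdx (n := 0) hf).continuous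
  have hcy : Continuous (pdy f) := (ContDiff.pdy (n := 0) hf).continuous
  have hA : Continuous fun y => ∫ s in (-1 : ℝ)..1, |pdx f (s, y)| :=
    continuous_integral_fst hcx.abs
  have hB : Continuous fun x => ∫ s in (-1 : ℝ)..1, |pdy f (x, s)| :=
    continuous_integral_snd hcy.abs
  have hA' : Continuous fun z : ℝ × ℝ => ∫ s in (-1 : ℝ)..1, |pdx f (s, z.2)| :=
    hA.comp continuous_snd
  have hB' : Continuous fun z : ℝ × ℝ => ∫ s in (-1 : ℝ)..1, |pdy f (z.1, s)| :=
    hB.comp continuous_fst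
  have key : ∀ x ∈ Set.Icc (-1 : ℝ) 1, ∀ y ∈ Set.Icc (-1 : ℝ) 1,
      |f (x, y) - sqInt f / 4| ≤ (∫ s in (-1 : ℝ)..1, |pdx f (s, y)|) +
        1 / 2 * sqInt fun z => |pdy f z| := by
    intro x hx y hy
    have h1 := abs_sqInt_le (f := fun z => f z - f (x, y)) (by fun_prop)
    rw [sqInt_sub_const hc, abs_sub_comm] at h1
    have h2 := sqInt_mono (f := fun z => |f z - f (x, y)|)
      (g := fun z => (∫ s in (-1 : ℝ)..1, |pdx f (s, y)|) +
        ∫ s in (-1 : ℝ)..1, |pdy f (z.1, s)|) (by fun_prop)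
        (continuous_const.add hB')
        fun x' hx' y' hy' => by
          rw [abs_sub_comm]
          exact abs_sub_le_of_contDiff_one hf hx hy hx' hy'
    rw [sqInt_add continuous_const hB', sqInt_const,
      sqInt_fst fun x => ∫ s in (-1 : ℝ)..1, |pdy f (x, s)|] at h2
    have e : |f (x, y) - sqInt f / 4| = |4 * f (x, y) - sqInt f| / 4 := by
      rw [← abs_of_pos (by norm_num : (0 : ℝ) < 4), ← abs_div,
        abs_of_pos (by norm_num : (0 : ℝ) < 4)]
      congr 1
      ring
    rw [e]
    change _ ≤ 4 * _ + 2 * (sqInt fun z => |pdy f z|) at h2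
    linarith
  have h3 := sqInt_mono (f := fun z => |f z - sqInt f / 4|)
    (g := fun z => (∫ s in (-1 : ℝ)..1, |pdx f (s, z.2)|) +
      1 / 2 * sqInt fun z => |pdy f z|) (by fun_prop)
      (hA'.add continuous_const) key
  rw [sqInt_add hA' continuous_const, sqInt_const,
    sqInt_snd fun y => ∫ s in (-1 : ℝ)..1, |pdx f (s, y)|, ← sqInt_swap hcx.abs] at h3
  linarith

theorem integral_abs_slice_snd_le {g : ℝ × ℝ → ℝ} (hg : ContDiff ℝ 1 g) {y : ℝ}
    (hy : y ∈ Set.Icc (-1 : ℝ) 1) :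
    ∫ s in (-1 : ℝ)..1, |g (s, y)| ≤
      1 / 2 * sqInt (fun z => |g z|) + sqInt fun z => |pdy g z| := by
  have hc : Continuous g := hg.continuous
  have hcy : Continuous (pdy g) := (ContDiff.pdy (n := 0) hg).continuous
  have h1 : Continuous fun x => 1 / 2 * ∫ s in (-1 : ℝ)..1, |g (x, s)| :=
    continuous_const.mul (continuous_integral_snd hc.abs)
  have h2 : Continuous fun x => ∫ s in (-1 : ℝ)..1, |pdy g (x, s)| :=
    continuous_integral_snd hcy.abs
  have h := integral_mono_symm (f := fun x => |g (x, y)|) (by fun_prop) (h1.fun_add h2) fun x _ =>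
    abs_le_integral_add_integral_abs_deriv
      (fun s => hasDerivAt_pdy (hg.differentiable (by norm_num)) x s) (by fun_prop) hy
  rw [intervalIntegral.integral_add (h1.intervalIntegrable _ _) (h2.intervalIntegrable _ _),
    intervalIntegral.integral_const_mul] at h
  exact h

theorem integral_abs_slice_fst_le {g : ℝ × ℝ → ℝ} (hg : ContDiff ℝ 1 g) {x : ℝ}
    (hx : x ∈ Set.Icc (-1 : ℝ) 1) :
    ∫ s in (-1 : ℝ)..1, |g (x, s)| ≤
      1 / 2 * sqInt (fun z => |g z|) + sqInt fun z => |pdx g z| := by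
  have hc : Continuous g := hg.continuous
  have hcx : Continuous (pdx g) := (ContDiff.pdx (n := 0) hg).continuous
  rw [sqInt_swap hc.abs, sqInt_swap hcx.abs]
  have h1 : Continuous fun y => 1 / 2 * ∫ s in (-1 : ℝ)..1, |g (s, y)| :=
    continuous_const.mul (continuous_integral_fst hc.abs)
  have h2 : Continuous fun y => ∫ s in (-1 : ℝ)..1, |pdx g (s, y)| :=
    continuous_integral_fst hcx.abs
  have h := integral_mono_symm (f := fun y => |g (x, y)|) (by fun_prop) (h1.fun_add h2) fun y _ =>
    abs_le_integral_add_integral_abs_deriv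
      (fun s => hasDerivAt_pdx (hg.differentiable (by norm_num)) s y) (by fun_prop) hx
  rw [intervalIntegral.integral_add (h1.intervalIntegrable _ _) (h2.intervalIntegrable _ _),
    intervalIntegral.integral_const_mul] at h
  exact h

theorem abs_sub_le_semi {g : ℝ × ℝ → ℝ} (hg : ContDiff ℝ 2 g) {x y x' y' : ℝ}
    (hx : x ∈ Set.Icc (-1 : ℝ) 1) (hy : y ∈ Set.Icc (-1 : ℝ) 1)
    (hx' : x' ∈ Set.Icc (-1 : ℝ) 1) (hy' : y' ∈ Set.Icc (-1 : ℝ) 1) :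
    |g (x, y) - g (x', y')| ≤ semi 1 g + 2 * semi 2 g := by
  have hg' : ContDiff ℝ (1 + 1 : ℕ) g := hg
  have h1 := integral_abs_slice_snd_le hg'.pdx hy
  have h2 := integral_abs_slice_fst_le hg'.pdy hx'
  have h3 := abs_sub_le_of_contDiff_one (hg.of_le (by norm_num)) hx hy hx' hy'
  rw [pdy_pdx_comm hg] at h1
  simp only [semi, Finset.sum_range_succ, Finset.sum_range_zero]
  simp only [Nat.sub_zero, Nat.sub_self, Nat.reduceSub, Function.iterate_succ_apply,
    Function.iterate_zero_apply, zero_add]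
  have p1 := sqInt_abs_nonneg (pdx (pdx g))
  have p2 := sqInt_abs_nonneg (pdy (pdy g))
  have p3 := sqInt_abs_nonneg (pdx g)
  have p4 := sqInt_abs_nonneg (pdy g)
  linarith

theorem memQ.mono {k l : ℕ} {q : MvPolynomial (Fin 2) ℝ} (h : memQ k q) (hkl : k ≤ l) :
    memQ l q :=
  ⟨h.1.trans hkl, h.2.trans hkl⟩

theorem memQ.add {k : ℕ} {q r : MvPolynomial (Fin 2) ℝ} (hq : memQ k q) (hr : memQ k r) :
    memQ k (q + r) :=
  ⟨(MvPolynomial.degreeOf_add_le _ _ _).trans (max_le hq.1 hr.1),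
    (MvPolynomial.degreeOf_add_le _ _ _).trans (max_le hq.2 hr.2)⟩

theorem memQ.sub {k : ℕ} {q r : MvPolynomial (Fin 2) ℝ} (hq : memQ k q) (hr : memQ k r) :
    memQ k (q - r) :=
  ⟨(MvPolynomial.degreeOf_sub_le _ _ _).trans (max_le hq.1 hr.1),
    (MvPolynomial.degreeOf_sub_le _ _ _).trans (max_le hq.2 hr.2)⟩

theorem memQ_C (k : ℕ) (c : ℝ) : memQ k (MvPolynomial.C c) := by
  simp [memQ]

theorem memQ_monomial (c : ℝ) {k a b : ℕ} (ha : a ≤ k) (hb : b ≤ k) :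
    memQ k (MvPolynomial.C c * MvPolynomial.X 0 ^ a * MvPolynomial.X 1 ^ b) := by
  have h0 : (MvPolynomial.X 0 ^ a : MvPolynomial (Fin 2) ℝ).degreeOf 0 = a := by simp
  have h1 : (MvPolynomial.X 1 ^ b : MvPolynomial (Fin 2) ℝ).degreeOf 1 = b := by simp
  have h2 : (MvPolynomial.X 0 ^ a : MvPolynomial (Fin 2) ℝ).degreeOf 1 = 0 :=
    MvPolynomial.degreeOf_X_pow_of_ne _ (by decide)
  have h3 : (MvPolynomial.X 1 ^ b : MvPolynomial (Fin 2) ℝ).degreeOf 0 = 0 :=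
    MvPolynomial.degreeOf_X_pow_of_ne _ (by decide)
  constructor <;> rw [mul_assoc] <;> refine (MvPolynomial.degreeOf_C_mul_le _ _ _).trans
    ((MvPolynomial.degreeOf_mul_le _ _ _).trans ?_)
  · omega
  · omega

theorem memQ_sum {ι : Type*} {k : ℕ} (s : Finset ι) (f : ι → MvPolynomial (Fin 2) ℝ)
    (h : ∀ i ∈ s, memQ k (f i)) : memQ k (∑ i ∈ s, f i) :=
  ⟨(MvPolynomial.degreeOf_sum_le _ _ _).trans (Finset.sup_le fun i hi => (h i hi).1),
    (MvPolynomial.degreeOf_sum_le _ _ _).trans (Finset.sup_le fun i hi => (h i hi).2)⟩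

theorem ev_add (q r : MvPolynomial (Fin 2) ℝ) (z : ℝ × ℝ) : ev (q + r) z = ev q z + ev r z := by
  simp [ev]

theorem ev_sub (q r : MvPolynomial (Fin 2) ℝ) (z : ℝ × ℝ) : ev (q - r) z = ev q z - ev r z := by
  simp [ev]

theorem ev_C (c : ℝ) (z : ℝ × ℝ) : ev (MvPolynomial.C c) z = c := by
  simp [ev]

theorem ev_sum_monomial {ι : Type*} (s : Finset ι) (c : ι → ℝ) (a b : ι → ℕ) :
    ev (∑ r ∈ s, MvPolynomial.C (c r) * MvPolynomial.X 0 ^ a r * MvPolynomial.X 1 ^ b r) =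
      fun z => ∑ r ∈ s, c r * z.1 ^ a r * z.2 ^ b r := by
  funext z
  simp [ev]

theorem semi_nonneg (n : ℕ) (f : ℝ × ℝ → ℝ) : 0 ≤ semi n f :=
  Finset.sum_nonneg fun _ _ => sqInt_abs_nonneg _

/-- Subtracting a suitable form of degree `n` makes all derivatives of order `n` mean-free. -/
theorem exists_homogeneous_correction (n : ℕ) {v : ℝ × ℝ → ℝ}
    (hv : ContDiff ℝ (n + 1 : ℕ) v) :
    ∃ Q : MvPolynomial (Fin 2) ℝ, memQ n Q ∧ ContDiff ℝ (n + 1 : ℕ) (v - ev Q) ∧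
      semi n (v - ev Q) ≤ 4 * semi (n + 1) v ∧ semi (n + 1) (v - ev Q) = semi (n + 1) v := by
  set c : ℕ → ℝ := fun r =>
    sqInt (pdx^[n - r] (pdy^[r] v)) / 4 / ((n - r).factorial * r.factorial) with hc
  have hQ := ev_sum_monomial (Finset.range (n + 1)) c (fun r => n - r) (fun r => r)
  set Q : MvPolynomial (Fin 2) ℝ := ∑ r ∈ Finset.range (n + 1),
    MvPolynomial.C (c r) * MvPolynomial.X 0 ^ (n - r) * MvPolynomial.X 1 ^ r
  have hQd : ContDiff ℝ (n + 1 : ℕ) (ev Q) := by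
    rw [hQ]
    fun_prop
  have hD : ∀ i j : ℕ, pdx^[i] (pdy^[j] (ev Q)) = fun z => ∑ r ∈ Finset.range (n + 1),
      c r * r.descFactorial j * (n - r).descFactorial i * z.1 ^ (n - r - i) * z.2 ^ (r - j) := by
    intro i j
    rw [hQ, pdy_iterate_sum_monomial, pdx_iterate_sum_monomial]
  have hD1 : ∀ j ≤ n, pdx^[n - j] (pdy^[j] (ev Q)) =
      fun _ => sqInt (pdx^[n - j] (pdy^[j] v)) / 4 := by
    intro j hj
    rw [hD]
    funext z
    rw [Finset.sum_eq_single j]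
    · have h1 : ((n - j).factorial : ℝ) ≠ 0 := by exact_mod_cast (n - j).factorial_ne_zero
      have h2 : (j.factorial : ℝ) ≠ 0 := by exact_mod_cast j.factorial_ne_zero
      simp only [hc, Nat.descFactorial_self, Nat.sub_self, pow_zero, mul_one]
      field_simp
    · intro r hr hrj
      rw [Finset.mem_range] at hr
      rcases lt_or_gt_of_ne hrj with h | h
      · simp [Nat.descFactorial_of_lt h]
      · simp [Nat.descFactorial_of_lt (by omega : n - r < n - j)]
    · intro h
      exact absurd (Finset.mem_range.2 (by omega)) h
  have hD2 : ∀ j ≤ n + 1, pdx^[n + 1 - j] (pdy^[j] (ev Q)) = fun _ => 0 := by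
    intro j hj
    rw [hD]
    funext z
    refine Finset.sum_eq_zero fun r hr => ?_
    rw [Finset.mem_range] at hr
    rcases lt_or_ge r j with h | h
    · simp [Nat.descFactorial_of_lt h]
    · simp [Nat.descFactorial_of_lt (by omega : n - r < n + 1 - j)]
  refine ⟨Q, memQ_sum _ _ fun r hr => memQ_monomial _ (Nat.sub_le _ _)
    (Nat.lt_succ_iff.1 (Finset.mem_range.1 hr)), hv.sub hQd, ?_, ?_⟩
  · have h1 : semi n (v - ev Q) ≤ ∑ r ∈ Finset.range (n + 1),
        2 * ((sqInt fun z => |pdx^[n + 1 - r] (pdy^[r] v) z|) +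
          sqInt fun z => |pdx^[n + 1 - (r + 1)] (pdy^[r + 1] v) z|) := by
      refine Finset.sum_le_sum fun r hr => ?_
      have hr' : r ≤ n := Nat.lt_succ_iff.1 (Finset.mem_range.1 hr)
      have hy : ContDiff ℝ (n - r + 1 : ℕ) (pdy^[r] v) :=
        ContDiff.pdy_iterate r (by rwa [show n - r + 1 + r = n + 1 by omega])
      have hf : ContDiff ℝ 1 (pdx^[n - r] (pdy^[r] v)) :=
        ContDiff.pdx_iterate (n := 1) (n - r) (by rwa [add_comm])
      have := poincare_sqInt hf
      rw [← Function.iterate_succ_apply' pdx, pdy_pdx_iterate_comm _ hy,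
        ← Function.iterate_succ_apply' pdy] at this
      rw [pdx_iterate_pdy_iterate_sub _ _ (hv.of_le (by norm_cast; omega))
        (hQd.of_le (by norm_cast; omega)), hD1 r hr', Nat.succ_sub hr', Nat.add_sub_add_right]
      exact this
    refine h1.trans ?_
    rw [← Finset.mul_sum, Finset.sum_add_distrib]
    have h2 : semi (n + 1) v = _ := Finset.sum_range_succ _ _
    have h3 : semi (n + 1) v = _ := Finset.sum_range_succ' _ _
    have h4 := sqInt_abs_nonneg (pdx^[n + 1 - (n + 1)] (pdy^[n + 1] v))
    have h5 := sqInt_abs_nonneg (pdx^[n + 1 - 0] (pdy^[0] v))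
    linarith
  · refine Finset.sum_congr rfl fun r hr => ?_
    have hr' : r ≤ n + 1 := Nat.lt_succ_iff.1 (Finset.mem_range.1 hr)
    rw [pdx_iterate_pdy_iterate_sub _ _ (hv.of_le (by norm_cast; omega))
        (hQd.of_le (by norm_cast; omega)), hD2 r hr']
    simp

/-- Bramble–Hilbert estimate in the maximum norm on the reference square. -/
theorem exists_memQ_abs_sub_le (n : ℕ) {v : ℝ × ℝ → ℝ} (hv : ContDiff ℝ (n + 2 : ℕ) v) :
    ∃ P : MvPolynomial (Fin 2) ℝ, memQ (n + 1) P ∧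
      ∀ x ∈ Set.Icc (-1 : ℝ) 1, ∀ y ∈ Set.Icc (-1 : ℝ) 1,
        |v (x, y) - ev P (x, y)| ≤ 6 * 4 ^ n * semi (n + 2) v := by
  induction n generalizing v with
  | zero =>
    obtain ⟨Q, hQ, hc, h1, h2⟩ := exists_homogeneous_correction 1 hv
    refine ⟨Q + MvPolynomial.C ((v - ev Q) (0, 0)),
      hQ.add (memQ_C _ _), fun x hx y hy => ?_⟩
    have := abs_sub_le_semi hc hx hy (x' := 0) (y' := 0) (by norm_num) (by norm_num)
    rw [h2] at this
    rw [ev_add, ev_C, ← sub_sub]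
    refine this.trans ?_
    norm_num at h1 ⊢
    linarith
  | succ n ih =>
    obtain ⟨Q, hQ, hc, h1, -⟩ := exists_homogeneous_correction (n + 2) hv
    obtain ⟨P, hP, h⟩ := ih (hc.of_le (by norm_cast; omega))
    refine ⟨Q + P, hQ.add (hP.mono (by omega)), fun x hx y hy => ?_⟩
    rw [ev_add, ← sub_sub]
    refine (h x hx y hy).trans ?_
    calc 6 * 4 ^ n * semi (n + 2) (v - ev Q)
        ≤ 6 * 4 ^ n * (4 * semi (n + 2 + 1) v) := by gcongr
      _ = 6 * 4 ^ (n + 1) * semi (n + 1 + 2) v := by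
        rw [show n + 2 + 1 = n + 1 + 2 by ring]
        ring

theorem memQ.exists_coeff {k : ℕ} {q : MvPolynomial (Fin 2) ℝ} (h : memQ k q) :
    ∃ c : Matrix (Fin (k + 1)) (Fin (k + 1)) ℝ,
      ev q = fun z => ∑ a, ∑ b, c a b * z.1 ^ (a : ℕ) * z.2 ^ (b : ℕ) := by
  refine ⟨fun a b => ∑ d ∈ q.support, if d 0 = a ∧ d 1 = b then q.coeff d else 0, ?_⟩
  funext z
  rw [ev, MvPolynomial.eval_eq']
  simp only [Finset.sum_mul]
  rw [Finset.sum_congr rfl fun a _ => Finset.sum_comm, Finset.sum_comm]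
  refine Finset.sum_congr rfl fun d hd => ?_
  have h0 : d 0 < k + 1 := Nat.lt_succ_iff.2 ((MvPolynomial.monomial_le_degreeOf 0 hd).trans h.1)
  have h1 : d 1 < k + 1 := Nat.lt_succ_iff.2 ((MvPolynomial.monomial_le_degreeOf 1 hd).trans h.2)
  rw [Finset.sum_eq_single ⟨d 0, h0⟩, Finset.sum_eq_single ⟨d 1, h1⟩]
  · simp [mul_assoc]
  · intro b _ hb
    rw [if_neg fun h => hb (Fin.ext h.2.symm), zero_mul, zero_mul]
  · simp
  · intro a _ ha
    refine Finset.sum_eq_zero fun b _ => ?_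
    rw [if_neg fun h => ha (Fin.ext h.1.symm), zero_mul, zero_mul]
  · simp

theorem continuous_ev (q : MvPolynomial (Fin 2) ℝ) : Continuous (ev q) := by
  unfold ev
  refine (MvPolynomial.continuous_eval q).comp (continuous_pi fun i => ?_)
  fin_cases i
  · exact continuous_fst
  · exact continuous_snd

/-- A tensor product of unisolvent families of univariate degrees of freedom controls a
polynomial on the reference square. -/
theorem exists_bound_of_tensor_dofs {k : ℕ} {ι : Type*} [Fintype ι] [DecidableEq ι]
    (M : Matrix ι (Fin (k + 1)) ℝ) (hM : ∀ c, M.mulVec c = 0 → c = 0) :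
    ∃ K : ℝ, 0 ≤ K ∧ ∀ (c : Matrix (Fin (k + 1)) (Fin (k + 1)) ℝ) (ε : ℝ),
      (∀ i j, |∑ a, ∑ b, c a b * M i a * M j b| ≤ ε) →
      ∀ x ∈ Set.Icc (-1 : ℝ) 1, ∀ y ∈ Set.Icc (-1 : ℝ) 1,
        |∑ a, ∑ b, c a b * x ^ (a : ℕ) * y ^ (b : ℕ)| ≤ K * ε := by
  obtain ⟨g, hg⟩ := (Matrix.toLin' M).exists_leftInverse_of_injective
    (LinearMap.ker_eq_bot'.2 fun c hc => hM c (by simpa using hc))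
  set N := LinearMap.toMatrix' g with hN
  have hNM : N * M = 1 := by
    have := congrArg LinearMap.toMatrix' hg
    rwa [LinearMap.toMatrix'_comp, LinearMap.toMatrix'_toLin', LinearMap.toMatrix'_id] at this
  refine ⟨∑ a, ∑ b, ∑ i, ∑ j, |N a i| * |N b j|, by positivity, fun c ε h x hx y hy => ?_⟩
  have hc : c = N * (M * c * M.transpose) * N.transpose := by
    calc c = (N * M) * c * (N * M).transpose := by rw [hNM]; simp
      _ = _ := by rw [Matrix.transpose_mul]; simp only [Matrix.mul_assoc]
  have hD : ∀ i j, |(M * c * M.transpose) i j| ≤ ε := by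
    intro i j
    convert h i j using 2
    simp only [Matrix.mul_apply, Matrix.transpose_apply, Finset.sum_mul]
    rw [Finset.sum_comm]
    exact Finset.sum_congr rfl fun _ _ => Finset.sum_congr rfl fun _ _ => by ring
  have hx' : |x| ≤ 1 := abs_le.2 hx
  have hy' : |y| ≤ 1 := abs_le.2 hy
  rw [Finset.sum_mul]
  refine (Finset.abs_sum_le_sum_abs _ _).trans (Finset.sum_le_sum fun a _ => ?_)
  rw [Finset.sum_mul]
  refine (Finset.abs_sum_le_sum_abs _ _).trans (Finset.sum_le_sum fun b _ => ?_)
  have h1 : |c a b * x ^ (a : ℕ) * y ^ (b : ℕ)| ≤ |c a b| := by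
    rw [abs_mul, abs_mul, abs_pow, abs_pow, mul_assoc]
    exact mul_le_of_le_one_right (abs_nonneg _)
      (mul_le_one₀ (pow_le_one₀ (abs_nonneg _) hx') (by positivity)
        (pow_le_one₀ (abs_nonneg _) hy'))
  refine h1.trans ?_
  have happly : ∀ D : Matrix ι ι ℝ,
      (N * D * N.transpose) a b = ∑ i, ∑ j, N a i * D i j * N b j := by
    intro D
    simp only [Matrix.mul_apply, Matrix.transpose_apply, Finset.sum_mul]
    exact Finset.sum_comm
  rw [hc, happly, Finset.sum_mul]
  refine (Finset.abs_sum_le_sum_abs _ _).trans (Finset.sum_le_sum fun i _ => ?_)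
  rw [Finset.sum_mul]
  refine (Finset.abs_sum_le_sum_abs _ _).trans (Finset.sum_le_sum fun j _ => ?_)
  rw [abs_mul, abs_mul, mul_right_comm]
  exact mul_le_mul_of_nonneg_left (hD i j) (by positivity)

theorem IsLag.exists_bound {k : ℕ} {s : Fin (k + 1) → ℝ} (hs : Function.Injective s) :
    ∃ K : ℝ, 0 ≤ K ∧ ∀ (g : ℝ × ℝ → ℝ) (q : MvPolynomial (Fin 2) ℝ) (ε : ℝ),
      IsLag k s g q → (∀ i j, |g (s i, s j)| ≤ ε) →
      ∀ x ∈ Set.Icc (-1 : ℝ) 1, ∀ y ∈ Set.Icc (-1 : ℝ) 1, |ev q (x, y)| ≤ K * ε := by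
  have hM : ∀ c, (Matrix.vandermonde s).mulVec c = 0 → c = 0 := fun c hc =>
    Matrix.eq_zero_of_mulVec_eq_zero (Matrix.det_vandermonde_ne_zero_iff.2 hs) hc
  obtain ⟨K, hK, h⟩ := exists_bound_of_tensor_dofs _ hM
  refine ⟨K, hK, fun g q ε hq hg => ?_⟩
  obtain ⟨c, hc⟩ := hq.1.exists_coeff
  have := h c ε fun i j => by
    simpa only [Matrix.vandermonde_apply, ← hq.2 i j, hc] using hg i j
  simpa only [hc] using this

/-- The univariate vertex and moment degrees of freedom, evaluated on the monomials. -/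
noncomputable def vecDof (p : ℕ) : Matrix (Bool ⊕ Fin p) (Fin (p + 2)) ℝ :=
  Sum.elim (fun e a => (cond e 1 (-1) : ℝ) ^ (a : ℕ))
    (fun j a => ∫ s in (-1 : ℝ)..1, s ^ (a : ℕ) * s ^ (j : ℕ))

theorem Polynomial.eq_zero_of_integral_weight_mul_sq_eq_zero {r : Polynomial ℝ}
    (h : ∫ s in (-1 : ℝ)..1, (1 - s ^ 2) * r.eval s ^ 2 = 0) : r = 0 := by
  by_contra hr
  obtain ⟨c, hc, hcr⟩ :=
    (Set.Ioo_infinite (by norm_num : (-1 : ℝ) < 1)).exists_notMem_finset r.roots.toFinset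
  rw [Multiset.mem_toFinset, Polynomial.mem_roots hr, Polynomial.IsRoot.def] at hcr
  have h1 : 0 < 1 - c ^ 2 := by nlinarith [hc.1, hc.2]
  refine (intervalIntegral.integral_pos (f := fun s => (1 - s ^ 2) * r.eval s ^ 2) (by norm_num)
    (by fun_prop) (fun s hs => ?_)
    ⟨c, Set.Ioo_subset_Icc_self hc, mul_pos h1 (by positivity)⟩).ne' h
  exact mul_nonneg (by nlinarith [hs.1, hs.2]) (sq_nonneg _)

theorem Polynomial.eq_zero_of_vertex_of_moments {p : ℕ} {P : Polynomial ℝ}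
    (hdeg : P.natDegree ≤ p + 1) (h1 : P.eval 1 = 0) (h2 : P.eval (-1) = 0)
    (h3 : ∀ j < p, ∫ s in (-1 : ℝ)..1, P.eval s * s ^ j = 0) : P = 0 := by
  obtain ⟨P₁, rfl⟩ := Polynomial.dvd_iff_isRoot.2 h1
  have h2' : P₁.eval (-1) = 0 := by
    rw [Polynomial.eval_mul] at h2
    exact (mul_eq_zero.1 h2).resolve_left (by norm_num)
  obtain ⟨r, rfl⟩ := Polynomial.dvd_iff_isRoot.2 h2'
  by_contra hne
  have hr : r ≠ 0 := by
    rintro rfl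
    simp at hne
  have hrdeg : r.natDegree < p := by
    rw [Polynomial.natDegree_mul (Polynomial.X_sub_C_ne_zero _)
      (mul_ne_zero (Polynomial.X_sub_C_ne_zero _) hr),
      Polynomial.natDegree_mul (Polynomial.X_sub_C_ne_zero _) hr, Polynomial.natDegree_X_sub_C,
      Polynomial.natDegree_X_sub_C] at hdeg
    omega
  refine hr (Polynomial.eq_zero_of_integral_weight_mul_sq_eq_zero ?_)
  set P := (Polynomial.X - Polynomial.C 1) * ((Polynomial.X - Polynomial.C (-1)) * r) with hP
  have e : (fun s : ℝ => (1 - s ^ 2) * r.eval s ^ 2) = fun s =>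
      ∑ j ∈ Finset.range p, -r.coeff j * (P.eval s * s ^ j) := by
    funext s
    have : ∑ j ∈ Finset.range p, -r.coeff j * (P.eval s * s ^ j) = -P.eval s * r.eval s := by
      rw [Polynomial.eval_eq_sum_range' hrdeg, Finset.mul_sum]
      exact Finset.sum_congr rfl fun _ _ => by ring
    rw [this, hP]
    simp only [Polynomial.eval_mul, Polynomial.eval_sub, Polynomial.eval_X, Polynomial.eval_C]
    ring
  rw [e, intervalIntegral.integral_finsetSum fun j _ =>
    Continuous.intervalIntegrable (by fun_prop) _ _]
  refine Finset.sum_eq_zero fun j hj => ?_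
  rw [intervalIntegral.integral_const_mul, h3 j (Finset.mem_range.1 hj), mul_zero]

theorem vecDof_injective (p : ℕ) (c : Fin (p + 2) → ℝ) (h : (vecDof p).mulVec c = 0) : c = 0 := by
  set P : Polynomial ℝ := ∑ a : Fin (p + 2), Polynomial.C (c a) * Polynomial.X ^ (a : ℕ) with hP
  have hev : ∀ s, P.eval s = ∑ a : Fin (p + 2), s ^ (a : ℕ) * c a := fun s => by
    rw [hP, Polynomial.eval_finsetSum]
    exact Finset.sum_congr rfl fun a _ => by
      rw [Polynomial.eval_mul, Polynomial.eval_C, Polynomial.eval_pow, Polynomial.eval_X, mul_comm]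
  have hP0 : P = 0 := by
    refine Polynomial.eq_zero_of_vertex_of_moments (p := p) ?_ ?_ ?_ ?_
    · exact Polynomial.natDegree_sum_le_of_forall_le _ _ fun a _ =>
        (Polynomial.natDegree_C_mul_X_pow_le _ _).trans (Nat.lt_succ_iff.1 a.2)
    · rw [hev]
      exact congrFun h (Sum.inl true)
    · rw [hev]
      exact congrFun h (Sum.inl false)
    · intro j hj
      have hjj := congrFun h (Sum.inr ⟨j, hj⟩)
      simp only [Matrix.mulVec, dotProduct, vecDof, Sum.elim_inr, Pi.zero_apply] at hjj
      rw [← hjj]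
      simp only [hev, Finset.sum_mul]
      rw [intervalIntegral.integral_finsetSum fun j _ =>
        Continuous.intervalIntegrable (by fun_prop) _ _]
      refine Finset.sum_congr rfl fun a _ => ?_
      rw [← intervalIntegral.integral_mul_const]
      simp only [mul_right_comm]
  funext a
  have := congrArg (fun q => Polynomial.coeff q a) hP0
  simpa [hP, Polynomial.finsetSum_coeff, Polynomial.coeff_X_pow, Fin.val_inj] using this

theorem abs_integral_le_two_mul {f : ℝ → ℝ} {ε : ℝ} (h : ∀ s ∈ Set.Icc (-1 : ℝ) 1, |f s| ≤ ε) :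
    |∫ s in (-1 : ℝ)..1, f s| ≤ 2 * ε := by
  have := intervalIntegral.norm_integral_le_of_norm_le_const (a := -1) (b := 1) (f := f) (C := ε)
    fun s hs => h s (by
      rw [Set.uIoc_of_le (by norm_num)] at hs
      exact Set.Ioc_subset_Icc_self hs)
  norm_num at this
  linarith

theorem abs_mul_le_of_abs_le_one {a b ε : ℝ} (ha : |a| ≤ ε) (hb : |b| ≤ 1) : |a * b| ≤ ε := by
  rw [abs_mul]
  exact (mul_le_of_le_one_right (abs_nonneg _) hb).trans ha

theorem abs_pow_le_one_of_mem {s : ℝ} (hs : s ∈ Set.Icc (-1 : ℝ) 1) (j : ℕ) : |s ^ j| ≤ 1 := by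
  rw [abs_pow]
  exact pow_le_one₀ (abs_nonneg _) (abs_le.2 hs)

theorem cond_mem_pair (e : Bool) : (cond e 1 (-1) : ℝ) ∈ ({-1, 1} : Set ℝ) := by
  cases e <;> simp

theorem cond_mem_Icc (e : Bool) : (cond e 1 (-1) : ℝ) ∈ Set.Icc (-1 : ℝ) 1 := by
  cases e <;> norm_num

theorem IsVEC.integral_edge_fst {k : ℕ} {g : ℝ × ℝ → ℝ} (hg : Continuous g)
    {q : MvPolynomial (Fin 2) ℝ} (hq : IsVEC k g q) {b : ℝ} (hb : b ∈ ({-1, 1} : Set ℝ)) {j : ℕ}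
    (hj : j ≤ k - 2) :
    ∫ s in (-1 : ℝ)..1, ev q (s, b) * s ^ j = ∫ s in (-1 : ℝ)..1, g (s, b) * s ^ j := by
  have h := hq.2.2.1 b hb (Polynomial.X ^ j) (by simpa using hj)
  have hc := continuous_ev q
  simp only [Polynomial.eval_pow, Polynomial.eval_X, sub_mul] at h
  rw [intervalIntegral.integral_sub (Continuous.intervalIntegrable (by fun_prop) _ _)
    (Continuous.intervalIntegrable (by fun_prop) _ _)] at h
  exact sub_eq_zero.1 h

theorem IsVEC.integral_edge_snd {k : ℕ} {g : ℝ × ℝ → ℝ} (hg : Continuous g)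
    {q : MvPolynomial (Fin 2) ℝ} (hq : IsVEC k g q) {a : ℝ} (ha : a ∈ ({-1, 1} : Set ℝ)) {j : ℕ}
    (hj : j ≤ k - 2) :
    ∫ s in (-1 : ℝ)..1, ev q (a, s) * s ^ j = ∫ s in (-1 : ℝ)..1, g (a, s) * s ^ j := by
  have h := hq.2.2.2.1 a ha (Polynomial.X ^ j) (by simpa using hj)
  have hc := continuous_ev q
  simp only [Polynomial.eval_pow, Polynomial.eval_X, sub_mul] at h
  rw [intervalIntegral.integral_sub (Continuous.intervalIntegrable (by fun_prop) _ _)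
    (Continuous.intervalIntegrable (by fun_prop) _ _)] at h
  exact sub_eq_zero.1 h

theorem IsVEC.sqInt_cell {k : ℕ} {g : ℝ × ℝ → ℝ} (hg : Continuous g)
    {q : MvPolynomial (Fin 2) ℝ} (hq : IsVEC k g q) {i j : ℕ} (hi : i ≤ k - 2) (hj : j ≤ k - 2) :
    sqInt (fun z => ev q z * (z.1 ^ i * z.2 ^ j)) =
      sqInt fun z => g z * (z.1 ^ i * z.2 ^ j) := by
  have h : sqInt (fun z => (ev q z - g z) * _) = 0 :=
    hq.2.2.2.2 _ (memQ_monomial 1 hi hj)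
  have hc := continuous_ev q
  have e : ∀ z : ℝ × ℝ, ev (MvPolynomial.C 1 * MvPolynomial.X 0 ^ i * MvPolynomial.X 1 ^ j) z =
      z.1 ^ i * z.2 ^ j := fun z => by simp [ev]
  simp only [e] at h
  have := sqInt_add (f := fun z => (ev q z - g z) * (z.1 ^ i * z.2 ^ j))
    (g := fun z => g z * (z.1 ^ i * z.2 ^ j)) (by fun_prop) (by fun_prop)
  rw [h, zero_add] at this
  rw [← this]
  congr 1
  funext z
  ring

theorem IsVEC.exists_bound (p : ℕ) :
    ∃ K : ℝ, 0 ≤ K ∧ ∀ (g : ℝ × ℝ → ℝ) (q : MvPolynomial (Fin 2) ℝ) (ε : ℝ),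
      Continuous g → IsVEC (p + 1) g q →
      (∀ x ∈ Set.Icc (-1 : ℝ) 1, ∀ y ∈ Set.Icc (-1 : ℝ) 1, |g (x, y)| ≤ ε) →
      ∀ x ∈ Set.Icc (-1 : ℝ) 1, ∀ y ∈ Set.Icc (-1 : ℝ) 1, |ev q (x, y)| ≤ K * ε := by
  obtain ⟨K, hK, h⟩ := exists_bound_of_tensor_dofs _ (vecDof_injective p)
  refine ⟨K * 4, by positivity, fun g q ε hg hq hε => ?_⟩
  have hε0 : 0 ≤ ε := (abs_nonneg _).trans (hε 0 (by norm_num) 0 (by norm_num))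
  obtain ⟨c, hc⟩ := hq.1.exists_coeff
  have hdeg : ∀ j : Fin p, (j : ℕ) ≤ p + 1 - 2 := fun j => by omega
  have hD : ∀ i j, |∑ a, ∑ b, c a b * vecDof p i a * vecDof p j b| ≤ 4 * ε := by
    rintro (e | i) (e' | j)
    · have h1 := hε _ (cond_mem_Icc e) _ (cond_mem_Icc e')
      rw [← hq.2.1 _ (cond_mem_pair e) _ (cond_mem_pair e'), hc] at h1
      exact h1.trans (by linarith)
    · have h1 := abs_integral_le_two_mul fun s hs => abs_mul_le_of_abs_le_one
        (hε _ (cond_mem_Icc e) s hs) (abs_pow_le_one_of_mem hs j)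
      rw [← hq.integral_edge_snd hg (cond_mem_pair e) (hdeg j), hc] at h1
      refine le_trans (le_of_eq ?_) (h1.trans (by linarith))
      simp only [Finset.sum_mul]
      rw [intervalIntegral.integral_finsetSum fun _ _ =>
        Continuous.intervalIntegrable (by fun_prop) _ _]
      refine congrArg _ (Finset.sum_congr rfl fun a _ => ?_)
      rw [intervalIntegral.integral_finsetSum fun _ _ =>
        Continuous.intervalIntegrable (by fun_prop) _ _]
      refine Finset.sum_congr rfl fun b _ => ?_
      simp only [vecDof, Sum.elim_inl, Sum.elim_inr, mul_assoc,
        intervalIntegral.integral_const_mul]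
    · have h1 := abs_integral_le_two_mul fun s hs => abs_mul_le_of_abs_le_one
        (hε s hs _ (cond_mem_Icc e')) (abs_pow_le_one_of_mem hs i)
      rw [← hq.integral_edge_fst hg (cond_mem_pair e') (hdeg i), hc] at h1
      refine le_trans (le_of_eq ?_) (h1.trans (by linarith))
      simp only [Finset.sum_mul]
      rw [intervalIntegral.integral_finsetSum fun _ _ =>
        Continuous.intervalIntegrable (by fun_prop) _ _]
      refine congrArg _ (Finset.sum_congr rfl fun a _ => ?_)
      rw [intervalIntegral.integral_finsetSum fun _ _ =>
        Continuous.intervalIntegrable (by fun_prop) _ _]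
      refine Finset.sum_congr rfl fun b _ => ?_
      rw [← intervalIntegral.integral_congr (f := fun s =>
        c a b * (cond e' 1 (-1) : ℝ) ^ (b : ℕ) * (s ^ (a : ℕ) * s ^ (i : ℕ)))
        fun s _ => by ring, intervalIntegral.integral_const_mul]
      simp only [vecDof, Sum.elim_inl, Sum.elim_inr]
      ring
    · have h1 := abs_integral_le_two_mul fun x hx => abs_integral_le_two_mul fun y hy =>
        abs_mul_le_of_abs_le_one (hε x hx y hy) (abs_mul_le_of_abs_le_one
          (abs_pow_le_one_of_mem hx i) (abs_pow_le_one_of_mem hy j))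
      change |sqInt fun z => g z * (z.1 ^ (i : ℕ) * z.2 ^ (j : ℕ))| ≤ _ at h1
      rw [← hq.sqInt_cell hg (hdeg i) (hdeg j), hc] at h1
      refine le_trans (le_of_eq ?_) (h1.trans (by linarith))
      refine congrArg _ (Eq.symm ?_)
      calc _ = ∫ x in (-1 : ℝ)..1, ∑ a : Fin (p + 2), ∑ b : Fin (p + 2),
            x ^ (a : ℕ) * x ^ (i : ℕ) * (c a b * vecDof p (Sum.inr j) b) := by
            refine intervalIntegral.integral_congr fun x _ => ?_
            simp only [Finset.sum_mul]
            rw [intervalIntegral.integral_finsetSum fun _ _ =>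
              Continuous.intervalIntegrable (by fun_prop) _ _]
            refine Finset.sum_congr rfl fun a _ => ?_
            rw [intervalIntegral.integral_finsetSum fun _ _ =>
              Continuous.intervalIntegrable (by fun_prop) _ _]
            refine Finset.sum_congr rfl fun b _ => ?_
            rw [← intervalIntegral.integral_congr (f := fun y =>
              x ^ (a : ℕ) * x ^ (i : ℕ) * c a b * (y ^ (b : ℕ) * y ^ (j : ℕ)))
              fun y _ => by ring, intervalIntegral.integral_const_mul, mul_assoc]
            rfl
        _ = _ := by
            rw [intervalIntegral.integral_finsetSum fun _ _ =>
              Continuous.intervalIntegrable (by fun_prop) _ _]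
            refine Finset.sum_congr rfl fun a _ => ?_
            rw [intervalIntegral.integral_finsetSum fun _ _ =>
              Continuous.intervalIntegrable (by fun_prop) _ _]
            refine Finset.sum_congr rfl fun b _ => ?_
            rw [intervalIntegral.integral_mul_const]
            simp only [vecDof, Sum.elim_inr]
            ring
  intro x hx y hy
  have := h c (4 * ε) hD x hx y hy
  rw [hc, mul_assoc]
  exact this

theorem IsVEC.sub {k : ℕ} {g : ℝ × ℝ → ℝ} {q P : MvPolynomial (Fin 2) ℝ}
    (hq : IsVEC k g q) (hP : memQ k P) : IsVEC k (fun z => g z - ev P z) (q - P) := by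
  obtain ⟨h1, h2, h3, h4, h5⟩ := hq
  refine ⟨h1.sub hP, fun a ha b hb => by rw [ev_sub, h2 a ha b hb], ?_, ?_, ?_⟩ <;>
    simpa only [ev_sub, sub_sub_sub_cancel_right]

theorem IsVEC.congr {k : ℕ} {g g' : ℝ × ℝ → ℝ} {q : MvPolynomial (Fin 2) ℝ}
    (hq : IsVEC k g q)
    (h : ∀ x ∈ Set.Icc (-1 : ℝ) 1, ∀ y ∈ Set.Icc (-1 : ℝ) 1, g (x, y) = g' (x, y)) :
    IsVEC k g' q := by
  have hm : ∀ a ∈ ({-1, 1} : Set ℝ), a ∈ Set.Icc (-1 : ℝ) 1 := by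
    rintro a (rfl | rfl) <;> norm_num
  have hu : ∀ s ∈ Set.uIcc (-1 : ℝ) 1, s ∈ Set.Icc (-1 : ℝ) 1 := by
    rw [Set.uIcc_of_le (by norm_num)]
    exact fun _ => id
  obtain ⟨h1, h2, h3, h4, h5⟩ := hq
  refine ⟨h1, fun a ha b hb => by rw [h2 a ha b hb, h a (hm a ha) b (hm b hb)],
    fun b hb r hr => ?_, fun a ha r hr => ?_, fun r hr => ?_⟩
  · rw [← h3 b hb r hr]
    exact intervalIntegral.integral_congr fun s hs => by
      simp only [h s (hu s hs) b (hm b hb)]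
  · rw [← h4 a ha r hr]
    exact intervalIntegral.integral_congr fun s hs => by
      simp only [h a (hm a ha) s (hu s hs)]
  · rw [← h5 r hr]
    exact intervalIntegral.integral_congr fun x hx => intervalIntegral.integral_congr fun y hy => by
      simp only [h x (hu x hx) y (hu y hy)]

/-- The operator `R` annihilates `Q_{p+1}` and is bounded in the maximum norm. -/
theorem exists_reference_bound (p : ℕ) {t : Fin (p + 1) → ℝ} (ht : Function.Injective t)
    (htm : ∀ i, t i ∈ Set.Icc (-1 : ℝ) 1) :
    ∃ K : ℝ, 0 ≤ K ∧ ∀ (v : ℝ × ℝ → ℝ) (P qP qd : MvPolynomial (Fin 2) ℝ) (ε : ℝ),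
      Continuous v → memQ (p + 1) P →
      (∀ x ∈ Set.Icc (-1 : ℝ) 1, ∀ y ∈ Set.Icc (-1 : ℝ) 1, |v (x, y) - ev P (x, y)| ≤ ε) →
      IsVEC (p + 1) v qP → IsLag p t (fun z => ev qP z - v z) qd →
      ∀ x ∈ Set.Icc (-1 : ℝ) 1, ∀ y ∈ Set.Icc (-1 : ℝ) 1,
        |ev qd (x, y) - (ev qP (x, y) - v (x, y))| ≤ K * ε := by
  obtain ⟨K₁, hK₁, h₁⟩ := IsVEC.exists_bound p
  obtain ⟨K₂, hK₂, h₂⟩ := IsLag.exists_bound ht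
  refine ⟨(K₂ + 1) * (K₁ + 1), by positivity, fun v P qP qd ε hv hP hε hqP hqd => ?_⟩
  have hd : ∀ x ∈ Set.Icc (-1 : ℝ) 1, ∀ y ∈ Set.Icc (-1 : ℝ) 1,
      |ev qP (x, y) - v (x, y)| ≤ (K₁ + 1) * ε := by
    intro x hx y hy
    have a1 := h₁ _ _ ε (hv.sub (continuous_ev P)) (hqP.sub hP) hε x hx y hy
    have a2 := abs_sub (ev (qP - P) (x, y)) (v (x, y) - ev P (x, y))
    rw [ev_sub] at a1 a2
    rw [sub_sub_sub_cancel_right] at a2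
    linarith [hε x hx y hy]
  intro x hx y hy
  have b1 := h₂ _ _ _ hqd (fun i j => hd _ (htm i) _ (htm j)) x hx y hy
  have b2 := abs_sub (ev qd (x, y)) (ev qP (x, y) - v (x, y))
  linarith [hd x hx y hy]

theorem derivative_legendre_ne_zero {p : ℕ} (hp : 1 ≤ p) :
    Polynomial.derivative (legendre p) ≠ 0 := by
  have hX : (Polynomial.X ^ 2 - 1 : Polynomial ℝ) = Polynomial.X ^ 2 - Polynomial.C 1 := by simp
  have hm : ((Polynomial.X ^ 2 - 1 : Polynomial ℝ) ^ p).Monic := by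
    rw [hX]
    exact (Polynomial.monic_X_pow_sub_C 1 two_ne_zero).pow p
  have hdeg : ((Polynomial.X ^ 2 - 1 : Polynomial ℝ) ^ p).natDegree = p - 1 + (p + 1) := by
    rw [Polynomial.natDegree_pow, hX, Polynomial.natDegree_X_pow_sub_C]
    omega
  rw [legendre, Polynomial.derivative_C_mul, ← Function.iterate_succ_apply' Polynomial.derivative]
  refine mul_ne_zero (Polynomial.C_ne_zero.2 (by positivity)) fun h => ?_
  have hc := congrArg (fun q => Polynomial.coeff q (p - 1)) h
  simp only [Polynomial.coeff_iterate_derivative, Polynomial.coeff_zero] at hc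
  rw [Nat.succ_eq_add_one, ← hdeg, hm.coeff_natDegree, hdeg, nsmul_eq_mul, mul_one,
    Nat.cast_eq_zero, Nat.descFactorial_eq_zero_iff_lt] at hc
  omega

theorem finite_setOf_isGLNodes {p : ℕ} (hp : 1 ≤ p) : {t | IsGLNodes p t}.Finite := by
  set Q := (1 - Polynomial.X ^ 2) * Polynomial.derivative (legendre p) with hQdef
  have hQ : Q ≠ 0 := by
    refine mul_ne_zero (fun h => ?_) (derivative_legendre_ne_zero hp)
    simpa using congrArg (Polynomial.eval (0 : ℝ)) h
  refine (Set.Finite.pi' fun _ => Q.roots.toFinset.finite_toSet).subset fun t ht i => ?_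
  rw [Finset.mem_coe, Multiset.mem_toFinset, Polynomial.mem_roots hQ, Polynomial.IsRoot.def]
  simpa [hQdef] using ht.2.2.2 i

theorem IsGLNodes.mem_Icc {p : ℕ} {t : Fin (p + 1) → ℝ} (ht : IsGLNodes p t) (i : Fin (p + 1)) :
    t i ∈ Set.Icc (-1 : ℝ) 1 :=
  ⟨ht.2.1 ▸ ht.1.monotone (Fin.zero_le i), ht.2.2.1 ▸ ht.1.monotone (Fin.le_last i)⟩

theorem exists_uniform_reference_bound {p : ℕ} (hp : 1 ≤ p) :
    ∃ K : ℝ, 0 ≤ K ∧ ∀ t : Fin (p + 1) → ℝ, IsGLNodes p t →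
      ∀ (v : ℝ × ℝ → ℝ) (P qP qd : MvPolynomial (Fin 2) ℝ) (ε : ℝ),
      Continuous v → memQ (p + 1) P →
      (∀ x ∈ Set.Icc (-1 : ℝ) 1, ∀ y ∈ Set.Icc (-1 : ℝ) 1, |v (x, y) - ev P (x, y)| ≤ ε) →
      IsVEC (p + 1) v qP → IsLag p t (fun z => ev qP z - v z) qd →
      ∀ x ∈ Set.Icc (-1 : ℝ) 1, ∀ y ∈ Set.Icc (-1 : ℝ) 1,
        |ev qd (x, y) - (ev qP (x, y) - v (x, y))| ≤ K * ε := by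
  have : Fintype {t : Fin (p + 1) → ℝ // IsGLNodes p t} := (finite_setOf_isGLNodes hp).fintype
  choose K hK h using fun t : {t : Fin (p + 1) → ℝ // IsGLNodes p t} =>
    exists_reference_bound p t.2.1.injective t.2.mem_Icc
  refine ⟨∑ t, K t, Finset.sum_nonneg fun t _ => hK t, fun t ht v P qP qd ε hv hP hε hqP hqd x hx
    y hy => (h ⟨t, ht⟩ v P qP qd ε hv hP hε hqP hqd x hx y hy).trans ?_⟩
  exact mul_le_mul_of_nonneg_right
    (Finset.single_le_sum (f := K) (fun t _ => hK t) (Finset.mem_univ _))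
    ((abs_nonneg _).trans (hε x hx y hy))

/-- A function which is `C^n` near a compact set agrees near that set with a globally `C^n`
function. -/
theorem ContDiffOn.exists_contDiff_eqOn {n : ℕ} {w : ℝ × ℝ → ℝ} {S U : Set (ℝ × ℝ)}
    (hw : ContDiffOn ℝ n w U) (hS : IsCompact S) (hU : IsOpen U) (hSU : S ⊆ U) :
    ∃ f : ℝ × ℝ → ℝ, ContDiff ℝ n f ∧ ∃ V, IsOpen V ∧ S ⊆ V ∧ Set.EqOn f w V := by
  obtain ⟨L, hL, hSL, hLU⟩ := exists_compact_between hS hU hSU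
  obtain ⟨φ, h1, h0, -⟩ := exists_contMDiffMap_one_nhds_of_subset_interior
    (modelWithCornersSelf ℝ (ℝ × ℝ)) (n := n) hS.isClosed hSL
  have hφ : ContDiff ℝ n φ := φ.contMDiff.contDiff
  refine ⟨fun z => φ z * w z, contDiff_iff_contDiffAt.2 fun z => ?_, ?_⟩
  · by_cases hz : z ∈ U
    · exact hφ.contDiffAt.mul (hw.contDiffAt (hU.mem_nhds hz))
    · refine (contDiffAt_const (c := (0 : ℝ))).congr_of_eventuallyEq ?_
      filter_upwards [hL.isClosed.isOpen_compl.mem_nhds fun h => hz (hLU h)] with y hy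
      rw [h0 y hy, zero_mul]
  · obtain ⟨V, hV, hSV, hV1⟩ := eventually_nhdsSet_iff_exists.1 h1
    exact ⟨V, hV, hSV, fun z hz => by simp only [hV1 z hz, one_mul]⟩

theorem pdx_const_mul_comp_Fmap (x0 y0 h k c : ℝ) (f : ℝ × ℝ → ℝ) :
    pdx (fun z => c * f (Fmap x0 y0 h k z)) =
      fun z => h / 2 * c * pdx f (Fmap x0 y0 h k z) := by
  funext z
  have e : (fun s => f (Fmap x0 y0 h k (s, z.2))) = fun s =>
      f (h / 2 * s + (x0 + h / 2), y0 + k * (z.2 + 1) / 2) := by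
    funext s
    simp only [Fmap]
    ring_nf
  have e' : h / 2 * z.1 + (x0 + h / 2) = x0 + h * (z.1 + 1) / 2 := by ring
  have d : deriv (fun s => f (h / 2 * s + (x0 + h / 2), y0 + k * (z.2 + 1) / 2)) z.1 = _ :=
    deriv_comp_mul_left (h / 2) (fun u => f (u + (x0 + h / 2), y0 + k * (z.2 + 1) / 2)) z.1
  rw [deriv_comp_add_const fun u => f (u, y0 + k * (z.2 + 1) / 2), e'] at d
  simp only [pdx]
  rw [deriv_const_mul_field, e, d]
  simp only [Fmap, smul_eq_mul]
  ring

theorem pdy_const_mul_comp_Fmap (x0 y0 h k c : ℝ) (f : ℝ × ℝ → ℝ) :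
    pdy (fun z => c * f (Fmap x0 y0 h k z)) =
      fun z => k / 2 * c * pdy f (Fmap x0 y0 h k z) := by
  funext z
  have e : (fun s => f (Fmap x0 y0 h k (z.1, s))) = fun s =>
      f (x0 + h * (z.1 + 1) / 2, k / 2 * s + (y0 + k / 2)) := by
    funext s
    simp only [Fmap]
    ring_nf
  have e' : k / 2 * z.2 + (y0 + k / 2) = y0 + k * (z.2 + 1) / 2 := by ring
  have d : deriv (fun s => f (x0 + h * (z.1 + 1) / 2, k / 2 * s + (y0 + k / 2))) z.2 = _ :=
    deriv_comp_mul_left (k / 2) (fun u => f (x0 + h * (z.1 + 1) / 2, u + (y0 + k / 2))) z.2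
  rw [deriv_comp_add_const fun u => f (x0 + h * (z.1 + 1) / 2, u), e'] at d
  simp only [pdy]
  rw [deriv_const_mul_field, e, d]
  simp only [Fmap, smul_eq_mul]
  ring

theorem pdx_iterate_const_mul_comp_Fmap (x0 y0 h k c : ℝ) (f : ℝ × ℝ → ℝ) (a : ℕ) :
    pdx^[a] (fun z => c * f (Fmap x0 y0 h k z)) =
      fun z => (h / 2) ^ a * c * pdx^[a] f (Fmap x0 y0 h k z) := by
  induction a generalizing f c with
  | zero => simp
  | succ a ih =>
    rw [Function.iterate_succ_apply, pdx_const_mul_comp_Fmap, ih]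
    funext z
    rw [Function.iterate_succ_apply, pow_succ]
    ring

theorem pdy_iterate_const_mul_comp_Fmap (x0 y0 h k c : ℝ) (f : ℝ × ℝ → ℝ) (a : ℕ) :
    pdy^[a] (fun z => c * f (Fmap x0 y0 h k z)) =
      fun z => (k / 2) ^ a * c * pdy^[a] f (Fmap x0 y0 h k z) := by
  induction a generalizing f c with
  | zero => simp
  | succ a ih =>
    rw [Function.iterate_succ_apply, pdy_const_mul_comp_Fmap, ih]
    funext z
    rw [Function.iterate_succ_apply, pow_succ]
    ring

theorem pdx_iterate_pdy_iterate_comp_Fmap (x0 y0 h k : ℝ) (f : ℝ × ℝ → ℝ) (a b : ℕ) :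
    pdx^[a] (pdy^[b] fun z => f (Fmap x0 y0 h k z)) =
      fun z => (h / 2) ^ a * (k / 2) ^ b * pdx^[a] (pdy^[b] f) (Fmap x0 y0 h k z) := by
  have := pdy_iterate_const_mul_comp_Fmap x0 y0 h k 1 f b
  simp only [one_mul, mul_one] at this
  rw [this, pdx_iterate_const_mul_comp_Fmap]

theorem sqInt_comp_Fmap {x0 y0 h k : ℝ} (hh : 0 < h) (hk : 0 < k) {G : ℝ × ℝ → ℝ}
    (hG : Continuous G) :
    sqInt (fun z => G (Fmap x0 y0 h k z)) =
      4 / (h * k) * ∫ z in Set.Icc (x0, y0) (x0 + h, y0 + k), G z := by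
  have hint : MeasureTheory.IntegrableOn G (Set.Icc x0 (x0 + h) ×ˢ Set.Icc y0 (y0 + k))
      (MeasureTheory.volume.prod MeasureTheory.volume) :=
    hG.continuousOn.integrableOn_compact (isCompact_Icc.prod isCompact_Icc)
  rw [← Set.Icc_prod_Icc, MeasureTheory.Measure.volume_eq_prod,
    MeasureTheory.setIntegral_prod _ hint, MeasureTheory.integral_Icc_eq_integral_Ioc,
    ← intervalIntegral.integral_of_le (by linarith)]
  have hy : ∀ x, ∫ y in Set.Icc y0 (y0 + k), G (x, y) =
      k / 2 * ∫ y in (-1 : ℝ)..1, G (x, y0 + k * (y + 1) / 2) := fun x => by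
    rw [MeasureTheory.integral_Icc_eq_integral_Ioc, ← intervalIntegral.integral_of_le (by linarith)]
    have := intervalIntegral.smul_integral_comp_mul_add (a := -1) (b := 1) (fun y => G (x, y))
      (k / 2) (y0 + k / 2)
    rw [smul_eq_mul] at this
    convert this.symm using 2
    · ring
    · ring
    · congr 1
      funext y
      ring_nf
  simp only [hy]
  have := intervalIntegral.smul_integral_comp_mul_add (a := -1) (b := 1)
    (fun x => k / 2 * ∫ y in (-1 : ℝ)..1, G (x, y0 + k * (y + 1) / 2)) (h / 2) (x0 + h / 2)
  have e1 : h / 2 * -1 + (x0 + h / 2) = x0 := by ring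
  have e2 : h / 2 * 1 + (x0 + h / 2) = x0 + h := by ring
  have e3 : ∀ x, h / 2 * x + (x0 + h / 2) = x0 + h * (x + 1) / 2 := fun x => by ring
  simp only [e1, e2, e3] at this
  rw [← this, intervalIntegral.integral_const_mul, smul_eq_mul]
  simp only [sqInt, Fmap]
  field_simp
  ring

theorem volume_real_Icc_prod {x0 y0 h k : ℝ} (hh : 0 ≤ h) (hk : 0 ≤ k) :
    MeasureTheory.volume.real (Set.Icc (x0, y0) (x0 + h, y0 + k)) = h * k := by
  rw [← Set.Icc_prod_Icc, MeasureTheory.Measure.volume_eq_prod, MeasureTheory.measureReal_prod_prod,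
    Real.volume_real_Icc_of_le (by linarith), Real.volume_real_Icc_of_le (by linarith)]
  ring

theorem integral_abs_le_sqrt_mul_l2norm {x0 y0 h k : ℝ} (hh : 0 < h) (hk : 0 < k)
    {G : ℝ × ℝ → ℝ} (hG : Continuous G) :
    ∫ z in Set.Icc (x0, y0) (x0 + h, y0 + k), |G z| ≤
      √(h * k) * l2norm (Set.Icc (x0, y0) (x0 + h, y0 + k)) G := by
  set S := Set.Icc (x0, y0) (x0 + h, y0 + k) with hS
  have hint : ∀ f : ℝ × ℝ → ℝ, Continuous f → MeasureTheory.IntegrableOn f S :=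
    fun f hf => hf.continuousOn.integrableOn_compact isCompact_Icc
  set I := ∫ z in S, |G z| with hI
  have hA : 0 < h * k := by positivity
  set c := I / (h * k) with hc
  have h0 : 0 ≤ ∫ z in S, (|G z| - c) ^ 2 := MeasureTheory.integral_nonneg fun z => sq_nonneg _
  have e : ∫ z in S, (|G z| - c) ^ 2 = (∫ z in S, G z ^ 2) - 2 * c * I + h * k * c ^ 2 := by
    have : ∀ z, (|G z| - c) ^ 2 = G z ^ 2 - 2 * c * |G z| + c ^ 2 := fun z => by
      rw [sub_sq, sq_abs]
      ring
    simp only [this]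
    rw [MeasureTheory.integral_add (hint _ (by fun_prop)) (hint _ (by fun_prop)),
      MeasureTheory.integral_sub (hint _ (by fun_prop)) (hint _ (by fun_prop)),
      MeasureTheory.integral_const_mul, MeasureTheory.setIntegral_const,
      volume_real_Icc_prod hh.le hk.le, smul_eq_mul]
  rw [e] at h0
  have hcI : c * (h * k) = I := div_mul_cancel₀ _ hA.ne'
  rw [l2norm, ← Real.sqrt_mul hA.le]
  refine Real.le_sqrt_of_sq_le ?_
  calc I ^ 2 = h * k * (2 * c * I - h * k * c ^ 2) := by
        rw [← hcI]
        ring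
    _ ≤ _ := mul_le_mul_of_nonneg_left (by linarith) hA.le

theorem l2norm_le_mul_sqrt {x0 y0 h k B : ℝ} (hh : 0 < h) (hk : 0 < k) (hB : 0 ≤ B)
    {f : ℝ × ℝ → ℝ} (hf : ∀ z ∈ Set.Icc (x0, y0) (x0 + h, y0 + k), |f z| ≤ B) :
    l2norm (Set.Icc (x0, y0) (x0 + h, y0 + k)) f ≤ B * √(h * k) := by
  have := MeasureTheory.norm_setIntegral_le_of_norm_le_const (μ := MeasureTheory.volume)
    (f := fun z => f z ^ 2) (C := B ^ 2) (isCompact_Icc (a := (x0, y0))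
      (b := (x0 + h, y0 + k))).measure_lt_top fun z hz => by
      rw [Real.norm_eq_abs, abs_pow]
      exact pow_le_pow_left₀ (abs_nonneg _) (hf z hz) 2
  rw [volume_real_Icc_prod hh.le hk.le, Real.norm_eq_abs] at this
  refine Real.sqrt_le_iff.2 ⟨by positivity, ((le_abs_self _).trans this).trans_eq ?_⟩
  rw [mul_pow, Real.sq_sqrt (by positivity)]

theorem semi_comp_Fmap_mul_sqrt_le {n : ℕ} {x0 y0 h k : ℝ} (hh : 0 < h) (hk : 0 < k)
    {f : ℝ × ℝ → ℝ} (hf : ContDiff ℝ n f) :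
    semi n (fun z => f (Fmap x0 y0 h k z)) * √(h * k) ≤
      4 * ∑ r ∈ Finset.range (n + 1), h ^ (n - r) * k ^ r *
        l2norm (Set.Icc (x0, y0) (x0 + h, y0 + k)) (pdx^[n - r] (pdy^[r] f)) := by
  rw [semi, Finset.sum_mul, Finset.mul_sum]
  refine Finset.sum_le_sum fun r hr => ?_
  have hrn : r ≤ n := Nat.lt_succ_iff.1 (Finset.mem_range.1 hr)
  have hD : Continuous (pdx^[n - r] (pdy^[r] f)) := by
    have hf' : ContDiff ℝ (0 + (n - r) + r : ℕ) f := by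
      rwa [zero_add, Nat.sub_add_cancel hrn]
    exact (ContDiff.pdx_iterate (n := 0) (n - r) (ContDiff.pdy_iterate r hf')).continuous
  set D := pdx^[n - r] (pdy^[r] f) with hDdef
  rw [pdx_iterate_pdy_iterate_comp_Fmap, ← hDdef]
  have e : (fun z => |(h / 2) ^ (n - r) * (k / 2) ^ r * D (Fmap x0 y0 h k z)|) =
      fun z => (h / 2) ^ (n - r) * (k / 2) ^ r * |D (Fmap x0 y0 h k z)| := by
    funext z
    rw [abs_mul, abs_of_nonneg (a := _ * _) (by positivity)]
  have hsq := Real.mul_self_sqrt (mul_pos hh hk).le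
  have hl : 0 ≤ l2norm (Set.Icc (x0, y0) (x0 + h, y0 + k)) D := Real.sqrt_nonneg _
  rw [e, sqInt_const_mul, sqInt_comp_Fmap (G := fun z => |D z|) hh hk hD.abs]
  calc _ ≤ h ^ (n - r) * k ^ r * (4 / (h * k) * (√(h * k) *
          l2norm (Set.Icc (x0, y0) (x0 + h, y0 + k)) D)) * √(h * k) := by
        have := integral_abs_le_sqrt_mul_l2norm (x0 := x0) (y0 := y0) hh hk hD
        have h2 : h / 2 ≤ h := by linarith
        have k2 : k / 2 ≤ k := by linarith
        have hI : 0 ≤ ∫ z in Set.Icc (x0, y0) (x0 + h, y0 + k), |D z| :=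
          MeasureTheory.integral_nonneg fun _ => abs_nonneg _
        gcongr
    _ = h ^ (n - r) * k ^ r * (4 / (h * k)) *
          l2norm (Set.Icc (x0, y0) (x0 + h, y0 + k)) D * (√(h * k) * √(h * k)) := by ring
    _ = _ := by
        rw [hsq]
        field_simp

theorem Fmap_mem_Icc {x0 y0 h k x y : ℝ} (hh : 0 < h) (hk : 0 < k) (hx : x ∈ Set.Icc (-1 : ℝ) 1)
    (hy : y ∈ Set.Icc (-1 : ℝ) 1) :
    Fmap x0 y0 h k (x, y) ∈ Set.Icc (x0, y0) (x0 + h, y0 + k) := by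
  obtain ⟨hx1, hx2⟩ := hx
  obtain ⟨hy1, hy2⟩ := hy
  refine ⟨⟨?_, ?_⟩, ⟨?_, ?_⟩⟩ <;> simp only [Fmap] <;> nlinarith

theorem Fmap_Finv {x0 y0 h k : ℝ} (hh : h ≠ 0) (hk : k ≠ 0) (z : ℝ × ℝ) :
    Fmap x0 y0 h k (Finv x0 y0 h k z) = z := by
  refine Prod.ext ?_ ?_ <;> simp only [Fmap, Finv] <;> field_simp <;> ring

theorem Finv_mem {x0 y0 h k : ℝ} (hh : 0 < h) (hk : 0 < k) {z : ℝ × ℝ}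
    (hz : z ∈ Set.Icc (x0, y0) (x0 + h, y0 + k)) :
    (Finv x0 y0 h k z).1 ∈ Set.Icc (-1 : ℝ) 1 ∧ (Finv x0 y0 h k z).2 ∈ Set.Icc (-1 : ℝ) 1 := by
  obtain ⟨⟨h1, h2⟩, ⟨h3, h4⟩⟩ := hz
  simp only at h1 h2 h3 h4
  have a1 : 0 ≤ 2 * (z.1 - x0) / h := div_nonneg (by linarith) hh.le
  have a2 : 2 * (z.1 - x0) / h ≤ 2 := (div_le_iff₀ hh).2 (by linarith)
  have b1 : 0 ≤ 2 * (z.2 - y0) / k := div_nonneg (by linarith) hk.le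
  have b2 : 2 * (z.2 - y0) / k ≤ 2 := (div_le_iff₀ hk).2 (by linarith)
  simp only [Finv]
  exact ⟨⟨by linarith, by linarith⟩, ⟨by linarith, by linarith⟩⟩

/-- Anisotropic `L²`-error estimate for `R^τ w = I_p^τ(π_{p+1}^τ w − w) − (π_{p+1}^τ w − w)`
on an arbitrary axis-parallel rectangle `τ = [x₀,x₀+h] × [y₀,y₀+k]`:
`‖R^τ w‖_{L²(τ)} ≤ C Σ_{r=0}^{m+2} h^{m+2−r} k^r ‖∂_x^{m+2−r} ∂_y^r w‖_{L²(τ)}`, with `C`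
depending only on `p` and `m` (`1 ≤ m ≤ p`), independent of `h`, `k` and `w`.  Here `qP`
is `π̂_{p+1}(w ∘ F_τ)` and `qd` is `Î_p(π̂_{p+1}(w ∘ F_τ) − w ∘ F_τ)`, so that
`R^τ w = (ev qd − (ev qP − w ∘ F_τ)) ∘ F_τ⁻¹` on `τ`. -/
theorem R_L2_anisotropic (p m : ℕ) (hp : 2 ≤ p) (hm1 : 1 ≤ m) (hm2 : m ≤ p) :
    ∃ C : ℝ, 0 < C ∧
      ∀ t : Fin (p + 1) → ℝ, IsGLNodes p t →
      ∀ x0 y0 h k : ℝ, 0 < h → 0 < k →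
      ∀ w : ℝ × ℝ → ℝ,
        (∃ U : Set (ℝ × ℝ), IsOpen U ∧ Set.Icc (x0, y0) (x0 + h, y0 + k) ⊆ U ∧
          ContDiffOn ℝ (m + 2 : ℕ) w U) →
      ∀ qP qd : MvPolynomial (Fin 2) ℝ,
        IsVEC (p + 1) (fun z => w (Fmap x0 y0 h k z)) qP →
        IsLag p t (fun z => ev qP z - w (Fmap x0 y0 h k z)) qd →
      l2norm (Set.Icc (x0, y0) (x0 + h, y0 + k))
          (fun z => ev qd (Finv x0 y0 h k z) - (ev qP (Finv x0 y0 h k z) - w z)) ≤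
        C * ∑ r ∈ Finset.range (m + 3),
          h ^ (m + 2 - r) * k ^ r *
            l2norm (Set.Icc (x0, y0) (x0 + h, y0 + k)) (pdx^[m + 2 - r] (pdy^[r] w)) := by
  obtain ⟨K, hK, hKb⟩ := exists_uniform_reference_bound (p := p) (by omega)
  refine ⟨K * (6 * 4 ^ m) * 4 + 1, by positivity, ?_⟩
  rintro t ht x0 y0 h k hh hk w ⟨U, hU, hSU, hw⟩ qP qd hqP hqd
  set S := Set.Icc (x0, y0) (x0 + h, y0 + k) with hS
  obtain ⟨f, hf, V, hV, hSV, hfw⟩ := hw.exists_contDiff_eqOn isCompact_Icc hU hSU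
  have hsq : ∀ x ∈ Set.Icc (-1 : ℝ) 1, ∀ y ∈ Set.Icc (-1 : ℝ) 1,
      w (Fmap x0 y0 h k (x, y)) = f (Fmap x0 y0 h k (x, y)) := fun x hx y hy =>
    (hfw (hSV (Fmap_mem_Icc hh hk hx hy))).symm
  have hv : ContDiff ℝ (m + 2 : ℕ) fun z => f (Fmap x0 y0 h k z) := by
    unfold Fmap
    fun_prop
  obtain ⟨P, hP, hPb⟩ := exists_memQ_abs_sub_le m hv
  have hqd' : IsLag p t (fun z => ev qP z - f (Fmap x0 y0 h k z)) qd :=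
    ⟨hqd.1, fun i j => by
      rw [hqd.2 i j]
      simp only [hsq _ (ht.mem_Icc i) _ (ht.mem_Icc j)]⟩
  have hb := hKb t ht _ P qP qd _ hv.continuous (hP.mono (by omega)) hPb (hqP.congr hsq) hqd'
  have hsemi := semi_nonneg (m + 2) fun z => f (Fmap x0 y0 h k z)
  have hsum : ∑ r ∈ Finset.range (m + 3), h ^ (m + 2 - r) * k ^ r *
        l2norm S (pdx^[m + 2 - r] (pdy^[r] w)) =
      ∑ r ∈ Finset.range (m + 2 + 1), h ^ (m + 2 - r) * k ^ r *
        l2norm S (pdx^[m + 2 - r] (pdy^[r] f)) := by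
    refine Finset.sum_congr rfl fun r _ => ?_
    congr 1
    refine congrArg Real.sqrt (MeasureTheory.setIntegral_congr_fun measurableSet_Icc fun z hz => ?_)
    simp only [pdx_iterate_eqOn hV (m + 2 - r) (pdy_iterate_eqOn hV r hfw) (hSV hz)]
  rw [hsum]
  have hfin := semi_comp_Fmap_mul_sqrt_le (x0 := x0) (y0 := y0) hh hk hf
  have hpos : 0 ≤ ∑ r ∈ Finset.range (m + 2 + 1), h ^ (m + 2 - r) * k ^ r *
      l2norm S (pdx^[m + 2 - r] (pdy^[r] f)) :=
    Finset.sum_nonneg fun r _ => mul_nonneg (by positivity) (Real.sqrt_nonneg _)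
  refine (l2norm_le_mul_sqrt hh hk
    (B := K * (6 * 4 ^ m * semi (m + 2) fun z => f (Fmap x0 y0 h k z))) (by positivity)
    fun z hz => ?_).trans ?_
  · have := hb _ (Finv_mem hh hk hz).1 _ (Finv_mem hh hk hz).2
    rw [Prod.mk.eta, Fmap_Finv hh.ne' hk.ne', hfw (hSV hz)] at this
    exact this
  · calc _ = K * (6 * 4 ^ m) * ((semi (m + 2) fun z => f (Fmap x0 y0 h k z)) * √(h * k)) := by ring
      _ ≤ K * (6 * 4 ^ m) * (4 * _) := mul_le_mul_of_nonneg_left hfin (by positivity)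
      _ ≤ _ := by linarith
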